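/- Let μ > 0 and define g : ℝ³ → [0,∞] by g(k) = ∫₀^∞ e^{−|k|²/(4t) − tμ²} t^{−2} dt. Then g(k) < ∞ for every k ≠ 0, g is nonnegative, and g is integrable over ℝ³, i.e. ∫_{ℝ³} g(k) dk < ∞. -/

import Mathlib

noncomputable section
open MeasureTheory Real Set

/-- Three-dimensional Euclidean space. -/
abbrev E3 := EuclideanSpace ℝ (Fin 3)

/-- `g(k) = ∫₀^∞ e^{−|k|²/(4t) − tμ²} t^{−2} dt`, valued in `[0,∞]`. -/
def rosenheadFourier (μ : ℝ) (k : E3) : ENNReal :=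
  ∫⁻ t in Ioi (0:ℝ), ENNReal.ofReal (Real.exp (-‖k‖ ^ 2 / (4 * t) - t * μ ^ 2) / t ^ 2)

lemma rf_gauss (b : ℝ) (hb : 0 < b) :
    ∫⁻ k : E3, ENNReal.ofReal (Real.exp (-b * ‖k‖ ^ 2))
      = ENNReal.ofReal ((π / b) ^ (3 / 2 : ℝ)) := by
  have h := GaussianFourier.integral_rexp_neg_mul_sq_norm (V := E3) hb
  have hf : (Module.finrank ℝ E3 : ℝ) = 3 := by simp
  rw [hf] at h
  have hpos : 0 < (π / b) ^ (3 / 2 : ℝ) := by positivity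
  have hi : Integrable (fun v : E3 => Real.exp (-b * ‖v‖ ^ 2)) := by
    by_contra hn
    rw [integral_undef hn] at h
    exact hpos.ne h
  rw [← h, ofReal_integral_eq_lintegral_ofReal hi]
  exact Filter.Eventually.of_forall fun v => (Real.exp_pos _).le

lemma rf_int (s c : ℝ) (hs : -1 < s) (hc : 0 < c) (C : ℝ) :
    ∫⁻ t in Ioi (0:ℝ), ENNReal.ofReal (C * (t ^ s * Real.exp (-c * t))) < ⊤ := by
  have h := integrableOn_rpow_mul_exp_neg_mul_rpow hs one_pos hc
  simp only [Real.rpow_one] at h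
  exact (h.const_mul C).lintegral_lt_top

theorem rosenheadFourier_finite_and_integrable (μ : ℝ) (hμ : 0 < μ) :
    (∀ k : E3, k ≠ 0 → rosenheadFourier μ k < ⊤) ∧
    (∀ k : E3, 0 ≤ rosenheadFourier μ k) ∧
    (∫⁻ k : E3, rosenheadFourier μ k) < ⊤ := by
  have hc : 0 < μ ^ 2 := by positivity
  refine ⟨fun k hk => ?_, fun k => zero_le, ?_⟩
  · have ha : 0 < ‖k‖ ^ 2 / 4 := by have := norm_pos_iff.2 hk; positivity
    set a := ‖k‖ ^ 2 / 4 with hadef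
    refine lt_of_le_of_lt ?_ (rf_int 0 (μ ^ 2) (by norm_num) hc (2 / a ^ 2))
    refine setLIntegral_mono' measurableSet_Ioi fun t ht => ENNReal.ofReal_le_ofReal ?_
    have ht : 0 < t := ht
    have e : -‖k‖ ^ 2 / (4 * t) - t * μ ^ 2 = -(a / t) + -μ ^ 2 * t := by
      rw [hadef]; field_simp; ring
    rw [e, Real.exp_add, Real.rpow_zero, one_mul, mul_div_right_comm]
    refine mul_le_mul_of_nonneg_right ?_ (Real.exp_pos _).le
    have hx : 0 < a / t := by positivity
    have h2 := Real.quadratic_le_exp_of_nonneg hx.le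
    have h3 : (a / t) ^ 2 / 2 ≤ Real.exp (a / t) := by linarith
    rw [Real.exp_neg, div_le_iff₀ (by positivity)]
    calc (Real.exp (a / t))⁻¹ ≤ ((a / t) ^ 2 / 2)⁻¹ := by gcongr
      _ = 2 / a ^ 2 * t ^ 2 := by field_simp
  · unfold rosenheadFourier
    rw [lintegral_lintegral_swap]
    · refine lt_of_le_of_lt ?_
        (rf_int (-1 / 2) (μ ^ 2) (by norm_num) hc ((4 * π) ^ (3 / 2 : ℝ)))
      refine setLIntegral_mono' measurableSet_Ioi fun t ht => ?_
      have ht : 0 < t := ht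
      have e : ∀ k : E3, ENNReal.ofReal (Real.exp (-‖k‖ ^ 2 / (4 * t) - t * μ ^ 2) / t ^ 2)
          = ENNReal.ofReal (Real.exp (-μ ^ 2 * t) / t ^ 2) *
            ENNReal.ofReal (Real.exp (-(1 / (4 * t)) * ‖k‖ ^ 2)) := by
        intro k
        rw [← ENNReal.ofReal_mul (by positivity), div_mul_eq_mul_div, ← Real.exp_add]
        congr 3
        ring
      simp_rw [e]
      rw [lintegral_const_mul' _ _ ENNReal.ofReal_ne_top, rf_gauss _ (by positivity),
        ← ENNReal.ofReal_mul (by positivity)]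
      refine ENNReal.ofReal_le_ofReal (le_of_eq ?_)
      have e1 : π / (1 / (4 * t)) = (4 * π) * t := by field_simp
      have e2 : t ^ (3 / 2 : ℝ) = t ^ (-1 / 2 : ℝ) * t ^ 2 := by
        rw [← Real.rpow_natCast t 2, ← Real.rpow_add ht]; norm_num
      rw [e1, Real.mul_rpow (by positivity) ht.le, e2]
      field_simp
    · apply Measurable.aemeasurable
      unfold Function.uncurry
      fun_prop
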